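/- In the setting of the truncated semidefinite relaxation of the measure-norm minimization: assume that for each N ≥ 1 the program (TrunSDP)_N admits a minimizer (a^{(N)}, z^{+,(N)}, z^{−,(N)}), and that program (Main) admits a minimizer. Then: (1) if (Main) has a unique minimizer a^opt ∈ ℝ^m, the sequence (a^{(N)})_{N≥1} converges to a^opt; (2) in general, every subsequence of (a^{(N)})_{N≥1} admits a further subsequence converging to some minimizer of (Main). -/

import Mathlib

open MeasureTheory Polynomial
open scoped ENNReal

noncomputable section

/-- The symmetric Toeplitz matrix with entries `(Toep z) j k = z_{|j-k|}` (0-indexed). -/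
def Toep {N : ℕ} (z : Fin N → ℝ) : Matrix (Fin N) (Fin N) ℝ :=
  Matrix.of fun j k => z ⟨Nat.dist j.1 k.1, by
    have hj := j.isLt; have hk := k.isLt; simp only [Nat.dist]; omega⟩

/-- Integral of a function against a finite signed Borel measure on `[-1,1]`,
via the Jordan decomposition. -/
def sInt (ν : SignedMeasure (Set.Icc (-1:ℝ) 1)) (f : (Set.Icc (-1:ℝ) 1) → ℝ) : ℝ :=
  (∫ x, f x ∂ν.toJordanDecomposition.posPart) - ∫ x, f x ∂ν.toJordanDecomposition.negPart

/-- Total variation norm of a signed measure on `[-1,1]`. -/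
def tvNorm (ν : SignedMeasure (Set.Icc (-1:ℝ) 1)) : ℝ := (ν.totalVariation Set.univ).toReal

/-- Truncated Chebyshev moment vector `M_N(ν) = (∫ T_{k-1} dν)_{k=1}^N` (0-indexed). -/
def chebMom (N : ℕ) (ν : SignedMeasure (Set.Icc (-1:ℝ) 1)) : Fin N → ℝ :=
  fun k => sInt ν (fun x => (Polynomial.Chebyshev.T ℝ ((k : ℕ) : ℤ)).eval (x : ℝ))

/-- Objective of program (Main). -/
def mainObj {m : ℕ} (lam : Fin m → SignedMeasure (Set.Icc (-1:ℝ) 1))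
    (ρ : SignedMeasure (Set.Icc (-1:ℝ) 1)) (ε η : ℝ) (p' : ℝ≥0∞) [Fact (1 ≤ p')]
    (a : Fin m → ℝ) : ℝ :=
  tvNorm (ρ - ∑ i, a i • lam i) + η / ε * ‖(WithLp.equiv p' (Fin m → ℝ)).symm a‖

/-- `a` is a minimizer of program (Main). -/
def IsMainMin {m n : ℕ} (lam : Fin m → SignedMeasure (Set.Icc (-1:ℝ) 1))
    (ρ : SignedMeasure (Set.Icc (-1:ℝ) 1)) (Mmat : Matrix (Fin n) (Fin m) ℝ)
    (bvec : Fin n → ℝ) (ε η : ℝ) (p' : ℝ≥0∞) [Fact (1 ≤ p')]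
    (a : Fin m → ℝ) : Prop :=
  Mmat.mulVec a = bvec ∧ ∀ a' : Fin m → ℝ, Mmat.mulVec a' = bvec →
    mainObj lam ρ ε η p' a ≤ mainObj lam ρ ε η p' a'

/-- Feasibility for program (TrunSDP)_N. -/
def trunFeas {m n N : ℕ} (lam : Fin m → SignedMeasure (Set.Icc (-1:ℝ) 1))
    (ρ : SignedMeasure (Set.Icc (-1:ℝ) 1)) (Mmat : Matrix (Fin n) (Fin m) ℝ)
    (bvec : Fin n → ℝ) (a : Fin m → ℝ) (zp zm : Fin N → ℝ) : Prop :=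
  Mmat.mulVec a = bvec ∧ zp - zm = chebMom N (ρ - ∑ i, a i • lam i) ∧
    (Toep zp).PosSemidef ∧ (Toep zm).PosSemidef

/-- Objective of program (TrunSDP)_N. -/
def trunObj {m N : ℕ} (hN : 0 < N) (ε η : ℝ) (p' : ℝ≥0∞) [Fact (1 ≤ p')]
    (a : Fin m → ℝ) (zp zm : Fin N → ℝ) : ℝ :=
  zp ⟨0, hN⟩ + zm ⟨0, hN⟩ + η / ε * ‖(WithLp.equiv p' (Fin m → ℝ)).symm a‖

theorem integrable_of_continuous_Icc (μ : Measure (Set.Icc (-1:ℝ) 1)) [IsFiniteMeasure μ]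
    {f : Set.Icc (-1:ℝ) 1 → ℝ} (hf : Continuous f) : Integrable f μ :=
  hf.integrable_of_hasCompactSupport (HasCompactSupport.of_compactSpace f)

theorem sInt_eq_of_eq_sub {ν : SignedMeasure (Set.Icc (-1:ℝ) 1)}
    {μ₁ μ₂ : Measure (Set.Icc (-1:ℝ) 1)} [IsFiniteMeasure μ₁] [IsFiniteMeasure μ₂]
    (hν : ν = μ₁.toSignedMeasure - μ₂.toSignedMeasure) (f : C(Set.Icc (-1:ℝ) 1, ℝ)) :
    sInt ν f = ∫ x, f x ∂μ₁ - ∫ x, f x ∂μ₂ := by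
  have hint : ∀ (μ : Measure (Set.Icc (-1:ℝ) 1)) [IsFiniteMeasure μ], Integrable f μ :=
    fun μ _ => integrable_of_continuous_Icc μ f.continuous
  have hj := ν.toSignedMeasure_toJordanDecomposition
  rw [JordanDecomposition.toSignedMeasure] at hj
  have hmeas : ν.toJordanDecomposition.posPart + μ₂ = μ₁ + ν.toJordanDecomposition.negPart := by
    rw [← Measure.toSignedMeasure_eq_toSignedMeasure_iff, Measure.toSignedMeasure_add,
      Measure.toSignedMeasure_add, ← sub_eq_sub_iff_add_eq_add, hj, hν]
  have h := congrArg (fun μ => ∫ x, f x ∂μ) hmeas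
  simp only [integral_add_measure (hint _) (hint _)] at h
  rw [sInt]
  linarith

theorem sInt_add (ν₁ ν₂ : SignedMeasure (Set.Icc (-1:ℝ) 1)) (f : C(Set.Icc (-1:ℝ) 1, ℝ)) :
    sInt (ν₁ + ν₂) f = sInt ν₁ f + sInt ν₂ f := by
  have hint : ∀ (μ : Measure (Set.Icc (-1:ℝ) 1)) [IsFiniteMeasure μ], Integrable f μ :=
    fun μ _ => integrable_of_continuous_Icc μ f.continuous
  have h₁ := ν₁.toSignedMeasure_toJordanDecomposition
  have h₂ := ν₂.toSignedMeasure_toJordanDecomposition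
  rw [JordanDecomposition.toSignedMeasure] at h₁ h₂
  rw [sInt_eq_of_eq_sub (ν := ν₁ + ν₂)
    (μ₁ := ν₁.toJordanDecomposition.posPart + ν₂.toJordanDecomposition.posPart)
    (μ₂ := ν₁.toJordanDecomposition.negPart + ν₂.toJordanDecomposition.negPart)]
  · rw [integral_add_measure (hint _) (hint _), integral_add_measure (hint _) (hint _), sInt, sInt]
    ring
  · rw [Measure.toSignedMeasure_add, Measure.toSignedMeasure_add, add_sub_add_comm, h₁, h₂]

theorem sInt_smul (r : ℝ) (ν : SignedMeasure (Set.Icc (-1:ℝ) 1)) (f : Set.Icc (-1:ℝ) 1 → ℝ) :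
    sInt (r • ν) f = r * sInt ν f := by
  rw [sInt, sInt, SignedMeasure.toJordanDecomposition_smul_real]
  rcases le_or_gt 0 r with hr | hr
  · rw [JordanDecomposition.real_smul_posPart_nonneg _ _ hr,
      JordanDecomposition.real_smul_negPart_nonneg _ _ hr, integral_smul_nnreal_measure,
      integral_smul_nnreal_measure, NNReal.smul_def, NNReal.smul_def, Real.coe_toNNReal _ hr,
      smul_eq_mul, smul_eq_mul]
    ring
  · rw [JordanDecomposition.real_smul_posPart_neg _ _ hr,
      JordanDecomposition.real_smul_negPart_neg _ _ hr, integral_smul_nnreal_measure,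
      integral_smul_nnreal_measure, NNReal.smul_def, NNReal.smul_def,
      Real.coe_toNNReal _ (neg_nonneg.2 hr.le), smul_eq_mul, smul_eq_mul]
    ring

/-- Integration of a fixed continuous function, as a linear functional of the signed measure. -/
def sIntLinear (f : C(Set.Icc (-1:ℝ) 1, ℝ)) : SignedMeasure (Set.Icc (-1:ℝ) 1) →ₗ[ℝ] ℝ where
  toFun ν := sInt ν f
  map_add' ν₁ ν₂ := sInt_add ν₁ ν₂ f
  map_smul' r ν := sInt_smul r ν f

theorem sInt_sub_sum_smul {m : ℕ} (lam : Fin m → SignedMeasure (Set.Icc (-1:ℝ) 1))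
    (ρ : SignedMeasure (Set.Icc (-1:ℝ) 1)) (f : C(Set.Icc (-1:ℝ) 1, ℝ)) (a : Fin m → ℝ) :
    sInt (ρ - ∑ i, a i • lam i) f = sInt ρ f - ∑ i, a i * sInt (lam i) f := by
  change sIntLinear f _ = sIntLinear f ρ - ∑ i, a i * sIntLinear f (lam i)
  simp [map_sub, map_sum]

theorem tvNorm_eq (ν : SignedMeasure (Set.Icc (-1:ℝ) 1)) :
    tvNorm ν = ν.toJordanDecomposition.posPart.real Set.univ +
      ν.toJordanDecomposition.negPart.real Set.univ := by
  rw [tvNorm, SignedMeasure.totalVariation, ← measureReal_def, measureReal_add_apply]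

theorem exists_polynomial_near_of_integrable (μ : Measure (Set.Icc (-1:ℝ) 1)) [IsFiniteMeasure μ]
    (f : Set.Icc (-1:ℝ) 1 → ℝ) (hf : Integrable f μ) (hf1 : ∀ x, |f x| ≤ 1) {δ : ℝ} (hδ : 0 < δ) :
    ∃ P : ℝ[X], (∀ x : Set.Icc (-1:ℝ) 1, |P.eval (x : ℝ)| ≤ 1 + δ) ∧
      ∫ x, |f x - P.eval (x : ℝ)| ∂μ ≤ δ + δ * μ.real Set.univ := by
  obtain ⟨g, hg, hgi⟩ := hf.exists_boundedContinuous_integral_sub_le hδ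
  let h : C(Set.Icc (-1:ℝ) 1, ℝ) := ⟨fun x => max (-1) (min 1 (g x)), by fun_prop⟩
  obtain ⟨P, hP⟩ := exists_polynomial_near_continuousMap (-1) 1 h δ hδ
  have hPh : ∀ x : Set.Icc (-1:ℝ) 1, |P.eval (x : ℝ) - h x| ≤ δ := fun x =>
    ((P.toContinuousMapOn _ - h).norm_coe_le_norm x).trans hP.le
  refine ⟨P, fun x => ?_, ?_⟩
  · have h1 : |h x| ≤ 1 := abs_le.2 ⟨le_max_left _ _, max_le (by norm_num) (min_le_left _ _)⟩
    calc |P.eval (x : ℝ)| = |h x + (P.eval (x : ℝ) - h x)| := by ring_nf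
      _ ≤ |h x| + |P.eval (x : ℝ) - h x| := abs_add_le _ _
      _ ≤ 1 + δ := add_le_add h1 (hPh x)
  · have hfh : ∀ x, |f x - h x| ≤ |f x - g x| := by
      intro x
      have hfx := abs_le.1 (hf1 x)
      have := abs_le.1 (le_refl |f x - g x|)
      change |f x - max (-1) (min 1 (g x))| ≤ _
      rcases le_total 1 (g x) with h1 | h1
      · rw [min_eq_left h1, max_eq_right (by norm_num), abs_le]
        constructor <;> linarith
      · rw [min_eq_right h1]
        rcases le_total (g x) (-1) with h2 | h2
        · rw [max_eq_left h2, abs_le]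
          constructor <;> linarith
        · rw [max_eq_right h2]
    have hPi : Integrable (fun x : Set.Icc (-1:ℝ) 1 => P.eval (x : ℝ)) μ :=
      integrable_of_continuous_Icc μ (P.continuous.comp continuous_subtype_val)
    have hfg : Integrable (fun x => ‖f x - g x‖) μ := (hf.sub hgi).norm
    calc ∫ x, |f x - P.eval (x : ℝ)| ∂μ ≤ ∫ x, (‖f x - g x‖ + δ) ∂μ := by
          refine integral_mono (hf.sub hPi).abs (hfg.add (integrable_const δ))
            fun x => ?_
          calc |f x - P.eval (x : ℝ)| = |(f x - h x) + (h x - P.eval (x : ℝ))| := by ring_nf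
            _ ≤ |f x - h x| + |h x - P.eval (x : ℝ)| := abs_add_le _ _
            _ ≤ ‖f x - g x‖ + δ := add_le_add (hfh x) (by rw [abs_sub_comm]; exact hPh x)
      _ = ∫ x, ‖f x - g x‖ ∂μ + δ * μ.real Set.univ := by
          rw [integral_add hfg (integrable_const δ), integral_const, smul_eq_mul,
            mul_comm δ]
      _ ≤ δ + δ * μ.real Set.univ := by gcongr

/-- The total variation norm is dominated by testing against polynomials. -/
theorem tvNorm_le_of_forall_polynomial (ν : SignedMeasure (Set.Icc (-1:ℝ) 1)) (S : ℝ)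
    (hS : ∀ (P : ℝ[X]) (B : ℝ), (∀ x : Set.Icc (-1:ℝ) 1, |P.eval (x : ℝ)| ≤ B) →
      sInt ν (fun x => P.eval (x : ℝ)) ≤ S * B) :
    tvNorm ν ≤ S := by
  classical
  set μp := ν.toJordanDecomposition.posPart with hμp
  set μn := ν.toJordanDecomposition.negPart with hμn
  obtain ⟨s, hs, hps, hns⟩ := ν.toJordanDecomposition.mutuallySingular
  let f : Set.Icc (-1:ℝ) 1 → ℝ := s.piecewise (fun _ => -1) (fun _ => 1)
  have hf1 : ∀ x, |f x| ≤ 1 := by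
    intro x
    by_cases hx : x ∈ s <;> simp [f, hx]
  have hfi : ∀ (μ : Measure (Set.Icc (-1:ℝ) 1)) [IsFiniteMeasure μ], Integrable f μ := by
    intro μ _
    exact Integrable.of_bound
      (Measurable.piecewise hs measurable_const measurable_const).aestronglyMeasurable 1
      (Filter.Eventually.of_forall hf1)
  have hfp : ∀ᵐ x ∂μp, f x = 1 := by
    filter_upwards [measure_eq_zero_iff_ae_notMem.1 hps] with x hx
    simp [f, hx]
  have hfn : ∀ᵐ x ∂μn, f x = -1 := by
    filter_upwards [measure_eq_zero_iff_ae_notMem.1 hns] with x hx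
    simp [f, not_not.1 hx]
  have htv : tvNorm ν = μp.real Set.univ + μn.real Set.univ := tvNorm_eq ν
  have key : ∀ δ : ℝ, 0 < δ → tvNorm ν ≤ S * (1 + δ) + (δ + δ * tvNorm ν) := by
    intro δ hδ
    obtain ⟨P, hPB, hPf⟩ := exists_polynomial_near_of_integrable (μp + μn) f (hfi _) hf1 hδ
    have hPi : ∀ (μ : Measure (Set.Icc (-1:ℝ) 1)) [IsFiniteMeasure μ],
        Integrable (fun x : Set.Icc (-1:ℝ) 1 => P.eval (x : ℝ)) μ := fun μ _ =>
      integrable_of_continuous_Icc μ (P.continuous.comp continuous_subtype_val)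
    have hpos : μp.real Set.univ - ∫ x, P.eval (x : ℝ) ∂μp ≤ ∫ x, |f x - P.eval (x : ℝ)| ∂μp := by
      have h1 : ∫ x, f x ∂μp = μp.real Set.univ := by
        rw [integral_congr_ae hfp, integral_const, smul_eq_mul, mul_one]
      rw [← h1, ← integral_sub (hfi _) (hPi _)]
      exact integral_mono ((hfi _).sub (hPi _)) ((hfi _).sub (hPi _)).abs fun x => le_abs_self _
    have hneg : μn.real Set.univ + ∫ x, P.eval (x : ℝ) ∂μn ≤ ∫ x, |f x - P.eval (x : ℝ)| ∂μn := by
      have h1 : ∫ x, f x ∂μn = -μn.real Set.univ := by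
        rw [integral_congr_ae hfn, integral_const, smul_eq_mul, mul_neg_one]
      have h2 : μn.real Set.univ + ∫ x, P.eval (x : ℝ) ∂μn =
          ∫ x, (P.eval (x : ℝ) - f x) ∂μn := by
        rw [integral_sub (hPi _) (hfi _), h1]
        ring
      rw [h2]
      exact integral_mono ((hPi _).sub (hfi _)) ((hfi _).sub (hPi _)).abs fun x =>
        (le_abs_self _).trans_eq (abs_sub_comm _ _)
    have hfP : ∀ (μ : Measure (Set.Icc (-1:ℝ) 1)) [IsFiniteMeasure μ],
        Integrable (fun x => |f x - P.eval (x : ℝ)|) μ := fun μ _ => ((hfi μ).sub (hPi μ)).abs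
    rw [integral_add_measure (hfP _) (hfP _),
      measureReal_add_apply, ← htv] at hPf
    have hSP := hS P (1 + δ) hPB
    rw [sInt, ← hμp, ← hμn] at hSP
    linarith
  have hlim : Filter.Tendsto (fun δ : ℝ => S * (1 + δ) + (δ + δ * tvNorm ν))
      (nhdsWithin 0 (Set.Ioi 0)) (nhds S) := by
    have hcont : Continuous fun δ : ℝ => S * (1 + δ) + (δ + δ * tvNorm ν) := by fun_prop
    have := hcont.tendsto 0
    simp only [add_zero, mul_one, zero_mul] at this
    exact this.mono_left nhdsWithin_le_nhds
  exact ge_of_tendsto hlim (by filter_upwards [self_mem_nhdsWithin] with δ hδ using key δ hδ)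

theorem eval_T_eq_cos (n : ℤ) {x : ℝ} (hx : x ∈ Set.Icc (-1:ℝ) 1) :
    (Chebyshev.T ℝ n).eval x = Real.cos (n * Real.arccos x) := by
  conv_lhs => rw [← Real.cos_arccos hx.1 hx.2]
  exact Chebyshev.T_real_cos _ _

theorem T_dist (j k : ℕ) : Chebyshev.T ℝ (Nat.dist j k : ℕ) = Chebyshev.T ℝ ((j : ℤ) - k) := by
  rcases le_total j k with h | h
  · rw [Nat.dist_eq_sub_of_le h, Nat.cast_sub h, ← Chebyshev.T_neg, neg_sub]
  · rw [Nat.dist_eq_sub_of_le_right h, Nat.cast_sub h]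

theorem Toep_isHermitian {N : ℕ} (z : Fin N → ℝ) : (Toep z).IsHermitian := by
  ext j k
  simp [Toep, Nat.dist_comm]

theorem sum_mul_mul_cos_sub {N : ℕ} (x : Fin N → ℝ) (θ : ℝ) :
    ∑ j, ∑ k, x j * x k * Real.cos ((((j : ℕ) : ℝ) - (k : ℕ)) * θ) =
      (∑ j, x j * Real.cos ((j : ℕ) * θ)) ^ 2 + (∑ j, x j * Real.sin ((j : ℕ) * θ)) ^ 2 := by
  rw [sq, sq, Finset.sum_mul_sum, Finset.sum_mul_sum, ← Finset.sum_add_distrib]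
  refine Finset.sum_congr rfl fun j _ => ?_
  rw [← Finset.sum_add_distrib]
  refine Finset.sum_congr rfl fun k _ => ?_
  rw [sub_mul, Real.cos_sub]
  ring

/-- Toeplitz matrices of Chebyshev moments of positive measures are positive semidefinite. -/
theorem posSemidef_Toep_moments (N : ℕ) (μ : Measure (Set.Icc (-1:ℝ) 1)) [IsFiniteMeasure μ] :
    (Toep fun k : Fin N =>
      ∫ x : Set.Icc (-1:ℝ) 1, (Chebyshev.T ℝ ((k : ℕ) : ℤ)).eval (x : ℝ) ∂μ).PosSemidef := by
  refine .of_dotProduct_mulVec_nonneg (Toep_isHermitian _) fun x => ?_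
  have hi : ∀ (n : ℤ) (c : ℝ),
      Integrable (fun t : Set.Icc (-1:ℝ) 1 => c * (Chebyshev.T ℝ n).eval (t : ℝ)) μ :=
    fun n c => integrable_of_continuous_Icc μ (by fun_prop)
  have hsum : star x ⬝ᵥ (Toep fun k : Fin N =>
      ∫ t : Set.Icc (-1:ℝ) 1, (Chebyshev.T ℝ ((k : ℕ) : ℤ)).eval (t : ℝ) ∂μ).mulVec x =
      ∫ t : Set.Icc (-1:ℝ) 1, ∑ j : Fin N, ∑ k : Fin N,
        x j * x k * (Chebyshev.T ℝ (((j : ℕ) : ℤ) - (k : ℕ))).eval (t : ℝ) ∂μ := by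
    rw [integral_finsetSum _ fun j _ => integrable_finsetSum _ fun k _ => hi _ _]
    simp only [dotProduct, Matrix.mulVec, Finset.mul_sum]
    refine Finset.sum_congr rfl fun j _ => ?_
    rw [integral_finsetSum _ fun k _ => hi _ _]
    refine Finset.sum_congr rfl fun k _ => ?_
    rw [integral_const_mul, ← T_dist]
    simp only [Toep, Matrix.of_apply, Pi.star_apply, star_trivial]
    ring
  rw [hsum]
  refine integral_nonneg fun t => ?_
  have ht : ∀ j k : Fin N, (Chebyshev.T ℝ (((j : ℕ) : ℤ) - (k : ℕ))).eval (t : ℝ) =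
      Real.cos ((((j : ℕ) : ℝ) - (k : ℕ)) * Real.arccos t) := by
    intro j k
    rw [eval_T_eq_cos _ t.2]
    push_cast
    rfl
  simp only [ht, sum_mul_mul_cos_sub]
  positivity

/-- The Fejér-type kernel attached to a Toeplitz matrix. -/
def toepKernel {N : ℕ} (z : Fin N → ℝ) (x : ℝ) : ℝ :=
  ∑ j : Fin N, ∑ k : Fin N, Toep z j k * (Chebyshev.T ℝ (((j : ℕ) : ℤ) - (k : ℕ))).eval x

theorem continuous_toepKernel {N : ℕ} (z : Fin N → ℝ) : Continuous (toepKernel z) := by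
  unfold toepKernel
  fun_prop

theorem toepKernel_nonneg {N : ℕ} {z : Fin N → ℝ} (hz : (Toep z).PosSemidef) {x : ℝ}
    (hx : x ∈ Set.Icc (-1:ℝ) 1) : 0 ≤ toepKernel z x := by
  have h1 := hz.dotProduct_mulVec_nonneg fun j : Fin N => Real.cos ((j : ℕ) * Real.arccos x)
  have h2 := hz.dotProduct_mulVec_nonneg fun j : Fin N => Real.sin ((j : ℕ) * Real.arccos x)
  have h : toepKernel z x = (star fun j : Fin N => Real.cos ((j : ℕ) * Real.arccos x)) ⬝ᵥ
        (Toep z).mulVec (fun j : Fin N => Real.cos ((j : ℕ) * Real.arccos x)) +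
      (star fun j : Fin N => Real.sin ((j : ℕ) * Real.arccos x)) ⬝ᵥ
        (Toep z).mulVec (fun j : Fin N => Real.sin ((j : ℕ) * Real.arccos x)) := by
    simp only [toepKernel, dotProduct, Matrix.mulVec, Finset.mul_sum, ← Finset.sum_add_distrib]
    refine Finset.sum_congr rfl fun j _ => Finset.sum_congr rfl fun k _ => ?_
    rw [eval_T_eq_cos _ hx]
    push_cast
    rw [sub_mul, Real.cos_sub]
    simp only [Pi.star_apply, star_trivial]
    ring
  rw [h]
  exact add_nonneg h1 h2

theorem integral_T_mul_T (n m : ℤ) :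
    ∫ x, (Chebyshev.T ℝ n).eval x * (Chebyshev.T ℝ m).eval x ∂Chebyshev.measureT =
      ((if n + m = 0 then Real.pi else 0) + (if n - m = 0 then Real.pi else 0)) / 2 := by
  have h : ∀ l : ℤ, ∫ x, (Chebyshev.T ℝ l).eval x ∂Chebyshev.measureT =
      if l = 0 then Real.pi else 0 := by
    intro l
    split_ifs with hl
    · rw [hl, Chebyshev.integral_eval_T_real_measureT_zero]
    · exact Chebyshev.integral_eval_T_real_measureT_of_ne_zero hl
  rw [Chebyshev.integral_eval_T_real_mul_eval_T_real_measureT, h, h]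

theorem sum_ite_add_eq {N : ℕ} (n : Fin N) (c : ℝ) :
    ∑ j : Fin N, ∑ k : Fin N, (if (j : ℕ) = k + n then c else 0) = ((N : ℝ) - (n : ℕ)) * c := by
  rw [Finset.sum_comm]
  have h : ∀ k : Fin N, ∑ j : Fin N, (if (j : ℕ) = k + n then c else 0) =
      if (k : ℕ) < N - n then c else 0 := by
    intro k
    split_ifs with hk
    · rw [Finset.sum_eq_single ⟨k + n, by omega⟩]
      · simp
      · intro j _ hj
        rw [if_neg fun h => hj (Fin.ext h)]
      · simp
    · refine Finset.sum_eq_zero fun j _ => if_neg ?_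
      omega
  simp only [h]
  rw [Fin.sum_univ_eq_sum_range (fun k => if k < N - (n : ℕ) then c else 0), ← Finset.sum_filter,
    Finset.sum_const, show (Finset.range N).filter (fun k => k < N - (n : ℕ)) =
      Finset.range (N - n) by ext k; simp; omega, Finset.card_range, nsmul_eq_mul,
    Nat.cast_sub n.2.le]

theorem integral_T_mul_toepKernel {N : ℕ} (z : Fin N → ℝ) (n : Fin N) :
    ∫ x, (Chebyshev.T ℝ ((n : ℕ) : ℤ)).eval x * toepKernel z x ∂Chebyshev.measureT =
      Real.pi * (((N : ℝ) - (n : ℕ)) * z n) := by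
  have hi : ∀ j k : Fin N, Integrable (fun x => Toep z j k * ((Chebyshev.T ℝ ((n : ℕ) : ℤ)).eval x *
      (Chebyshev.T ℝ (((j : ℕ) : ℤ) - (k : ℕ))).eval x)) Chebyshev.measureT := fun j k =>
    Chebyshev.integrable_measureT (by fun_prop)
  have hexp : ∀ x, (Chebyshev.T ℝ ((n : ℕ) : ℤ)).eval x * toepKernel z x =
      ∑ j : Fin N, ∑ k : Fin N, Toep z j k * ((Chebyshev.T ℝ ((n : ℕ) : ℤ)).eval x *
        (Chebyshev.T ℝ (((j : ℕ) : ℤ) - (k : ℕ))).eval x) := by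
    intro x
    simp only [toepKernel, Finset.mul_sum]
    refine Finset.sum_congr rfl fun j _ => Finset.sum_congr rfl fun k _ => ?_
    ring
  simp only [hexp]
  rw [integral_finsetSum _ fun j _ => integrable_finsetSum _ fun k _ => hi j k]
  have hterm : ∀ j k : Fin N, ∫ x, Toep z j k * ((Chebyshev.T ℝ ((n : ℕ) : ℤ)).eval x *
      (Chebyshev.T ℝ (((j : ℕ) : ℤ) - (k : ℕ))).eval x) ∂Chebyshev.measureT =
      (if (k : ℕ) = j + n then Real.pi / 2 * z n else 0) +
        (if (j : ℕ) = k + n then Real.pi / 2 * z n else 0) := by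
    intro j k
    rw [integral_const_mul, integral_T_mul_T]
    have h1 : ((n : ℕ) : ℤ) + (((j : ℕ) : ℤ) - (k : ℕ)) = 0 ↔ (k : ℕ) = j + n := by omega
    have h2 : ((n : ℕ) : ℤ) - (((j : ℕ) : ℤ) - (k : ℕ)) = 0 ↔ (j : ℕ) = k + n := by omega
    simp only [h1, h2]
    have hT : (k : ℕ) = j + n ∨ (j : ℕ) = k + n → Toep z j k = z n := by
      intro h
      refine congrArg z (Fin.ext ?_)
      simp only [Nat.dist]
      omega
    split_ifs with hk hj hj
    · rw [hT (Or.inl hk)]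
      ring
    · rw [hT (Or.inl hk)]
      ring
    · rw [hT (Or.inr hj)]
      ring
    · ring
  have hsum : ∀ j : Fin N, ∫ x, ∑ k : Fin N, Toep z j k * ((Chebyshev.T ℝ ((n : ℕ) : ℤ)).eval x *
      (Chebyshev.T ℝ (((j : ℕ) : ℤ) - (k : ℕ))).eval x) ∂Chebyshev.measureT =
      ∑ k : Fin N, (if (k : ℕ) = j + n then Real.pi / 2 * z n else 0) +
        ∑ k : Fin N, (if (j : ℕ) = k + n then Real.pi / 2 * z n else 0) := by
    intro j
    rw [integral_finsetSum _ fun k _ => hi j k, ← Finset.sum_add_distrib]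
    exact Finset.sum_congr rfl fun k _ => hterm j k
  simp only [hsum]
  rw [Finset.sum_add_distrib, sum_ite_add_eq, Finset.sum_comm, sum_ite_add_eq]
  ring

theorem abs_le_of_posSemidef_Toep {N : ℕ} (hN : 0 < N) {z : Fin N → ℝ} (hz : (Toep z).PosSemidef)
    (k : Fin N) : |z k| ≤ z ⟨0, hN⟩ := by
  have h : ∀ r : ℝ, r ^ 2 = 1 → 0 ≤ z ⟨0, hN⟩ + r * z k := by
    intro r hr
    have h1 := hz.dotProduct_mulVec_nonneg (Pi.single ⟨0, hN⟩ 1 + Pi.single k r)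
    have hval : star (Pi.single ⟨0, hN⟩ 1 + Pi.single k r : Fin N → ℝ) ⬝ᵥ
        (Toep z).mulVec (Pi.single ⟨0, hN⟩ 1 + Pi.single k r) =
        (1 + r ^ 2) * z ⟨0, hN⟩ + 2 * (r * z k) := by
      simp [Matrix.mulVec_add, Toep, Nat.dist]
      ring
    rw [hval, hr] at h1
    linarith
  have h1 := h 1 (by norm_num)
  have h2 := h (-1) (by norm_num)
  exact abs_le.2 ⟨by linarith, by linarith⟩

/-- A functional with positive semidefinite Toeplitz matrix of Chebyshev moments is almost bounded
by the supremum norm, with an error of order `1 / N`. -/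
theorem abs_sum_mul_le_of_posSemidef_Toep {N : ℕ} (hN : 0 < N) {z : Fin N → ℝ}
    (hz : (Toep z).PosSemidef) (c : Fin N → ℝ) {B : ℝ}
    (hB : ∀ x ∈ Set.Icc (-1:ℝ) 1, |∑ k, c k * (Chebyshev.T ℝ ((k : ℕ) : ℤ)).eval x| ≤ B) :
    |∑ k, c k * z k| ≤ (B + (∑ k, |c k| * (k : ℕ)) / N) * z ⟨0, hN⟩ := by
  have hN' : (0 : ℝ) < N := Nat.cast_pos.2 hN
  have hK := continuous_toepKernel z
  have hcheb : ∀ k : Fin N, Integrable (fun x => c k * ((Chebyshev.T ℝ ((k : ℕ) : ℤ)).eval x *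
      toepKernel z x)) Chebyshev.measureT := fun k =>
    Chebyshev.integrable_measureT (by fun_prop)
  have hP : ∫ x, (∑ k, c k * (Chebyshev.T ℝ ((k : ℕ) : ℤ)).eval x) * toepKernel z x
      ∂Chebyshev.measureT = Real.pi * ∑ k : Fin N, c k * (((N : ℝ) - (k : ℕ)) * z k) := by
    simp only [Finset.sum_mul, mul_assoc]
    rw [integral_finsetSum _ fun k _ => hcheb k, Finset.mul_sum]
    refine Finset.sum_congr rfl fun k _ => ?_
    rw [integral_const_mul, integral_T_mul_toepKernel]
    ring
  have hone : ∫ x, B * toepKernel z x ∂Chebyshev.measureT = Real.pi * (B * (N * z ⟨0, hN⟩)) := by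
    have := integral_T_mul_toepKernel z ⟨0, hN⟩
    simp only [Nat.cast_zero, Chebyshev.T_zero, eval_one, one_mul, sub_zero] at this
    rw [integral_const_mul, this]
    ring
  have hle : |∑ k : Fin N, c k * (((N : ℝ) - (k : ℕ)) * z k)| ≤ B * (N * z ⟨0, hN⟩) := by
    refine le_of_mul_le_mul_left ?_ Real.pi_pos
    rw [← abs_of_pos Real.pi_pos, ← abs_mul, abs_of_pos Real.pi_pos, ← hP, ← hone,
      Chebyshev.integral_measureT_eq_integral_cos, Chebyshev.integral_measureT_eq_integral_cos]
    refine (intervalIntegral.abs_integral_le_integral_abs Real.pi_pos.le).trans ?_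
    refine intervalIntegral.integral_mono_on Real.pi_pos.le
      (Continuous.intervalIntegrable (by fun_prop) _ _)
      (Continuous.intervalIntegrable (by fun_prop) _ _) fun θ _ => ?_
    rw [abs_mul, abs_of_nonneg (toepKernel_nonneg hz (Real.cos_mem_Icc θ))]
    exact mul_le_mul_of_nonneg_right (hB _ (Real.cos_mem_Icc θ))
      (toepKernel_nonneg hz (Real.cos_mem_Icc θ))
  have hsplit : (N : ℝ) * ∑ k, c k * z k =
      ∑ k : Fin N, c k * (((N : ℝ) - (k : ℕ)) * z k) + ∑ k : Fin N, c k * (k : ℕ) * z k := by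
    rw [Finset.mul_sum, ← Finset.sum_add_distrib]
    exact Finset.sum_congr rfl fun k _ => by ring
  have hrest : |∑ k : Fin N, c k * (k : ℕ) * z k| ≤ (∑ k, |c k| * (k : ℕ)) * z ⟨0, hN⟩ := by
    rw [Finset.sum_mul]
    refine (Finset.abs_sum_le_sum_abs _ _).trans (Finset.sum_le_sum fun k _ => ?_)
    rw [abs_mul, abs_mul, Nat.abs_cast]
    exact mul_le_mul_of_nonneg_left (abs_le_of_posSemidef_Toep hN hz k) (by positivity)
  refine le_of_mul_le_mul_left ?_ hN'
  calc (N : ℝ) * |∑ k, c k * z k| = |(N : ℝ) * ∑ k, c k * z k| := by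
        rw [abs_mul, abs_of_pos hN']
    _ ≤ B * (N * z ⟨0, hN⟩) + (∑ k, |c k| * (k : ℕ)) * z ⟨0, hN⟩ := by
        rw [hsplit]
        exact (abs_add_le _ _).trans (add_le_add hle hrest)
    _ = N * ((B + (∑ k, |c k| * (k : ℕ)) / N) * z ⟨0, hN⟩) := by
        field_simp

theorem exists_finsupp_chebyshev (P : ℝ[X]) :
    ∃ c : ℕ →₀ ℝ, P = c.sum fun k r => r • Chebyshev.T ℝ (k : ℤ) := by
  have hspan := (Chebyshev.chebyshevTsequence ℝ).span fun i => by
    rw [isUnit_iff_ne_zero, leadingCoeff_ne_zero]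
    exact (Chebyshev.chebyshevTsequence ℝ).ne_zero i
  have hP : P ∈ Submodule.span ℝ (Set.range (Chebyshev.chebyshevTsequence ℝ)) := by
    rw [hspan]
    exact Submodule.mem_top
  obtain ⟨c, hc⟩ := (Finsupp.mem_span_range_iff_exists_finsupp).1 hP
  exact ⟨c, hc.symm⟩

theorem finsupp_sum_eq_sum_fin {M : Type*} [AddCommMonoid M] (c : ℕ →₀ ℝ) (g : ℕ → ℝ → M)
    (hg : ∀ k, g k 0 = 0) {N : ℕ} (hN : ∀ k ∈ c.support, k < N) :
    c.sum g = ∑ k : Fin N, g k (c k) := by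
  rw [Fin.sum_univ_eq_sum_range (fun k => g k (c k)) N]
  exact Finsupp.sum_of_support_subset c (fun k hk => Finset.mem_range.2 (hN k hk)) g
    fun k _ => hg k

theorem sInt_sum_mul (ν : SignedMeasure (Set.Icc (-1:ℝ) 1)) {N : ℕ} (c : Fin N → ℝ)
    (f : Fin N → Set.Icc (-1:ℝ) 1 → ℝ) (hf : ∀ k, Continuous (f k)) :
    sInt ν (fun x => ∑ k, c k * f k x) = ∑ k, c k * sInt ν (f k) := by
  have hi : ∀ (μ : Measure (Set.Icc (-1:ℝ) 1)) [IsFiniteMeasure μ],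
      ∫ x, ∑ k, c k * f k x ∂μ = ∑ k, c k * ∫ x, f k x ∂μ := by
    intro μ _
    rw [integral_finsetSum _ fun k _ => (integrable_of_continuous_Icc μ (hf k)).const_mul (c k)]
    exact Finset.sum_congr rfl fun k _ => integral_const_mul _ _
  simp only [sInt, hi, mul_sub, Finset.sum_sub_distrib]

/-- Feasible points of the truncated program control polynomial test functionals, up to `O(1/N)`. -/
theorem exists_sInt_le_of_trunFeas {m n : ℕ} (lam : Fin m → SignedMeasure (Set.Icc (-1:ℝ) 1))
    (ρ : SignedMeasure (Set.Icc (-1:ℝ) 1)) (Mmat : Matrix (Fin n) (Fin m) ℝ) (bvec : Fin n → ℝ)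
    (P : ℝ[X]) {B : ℝ} (hB : ∀ x : Set.Icc (-1:ℝ) 1, |P.eval (x : ℝ)| ≤ B) :
    ∃ (C : ℝ) (d : ℕ), 0 ≤ C ∧ ∀ (N : ℕ) (hN : 0 < N), d ≤ N →
      ∀ (a : Fin m → ℝ) (zp zm : Fin N → ℝ), trunFeas lam ρ Mmat bvec a zp zm →
        sInt (ρ - ∑ i, a i • lam i) (fun x => P.eval (x : ℝ)) ≤
          (B + C / N) * (zp ⟨0, hN⟩ + zm ⟨0, hN⟩) := by
  obtain ⟨c, hc⟩ := exists_finsupp_chebyshev P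
  refine ⟨c.sum fun k r => |r| * k, c.support.sup id + 1,
    Finset.sum_nonneg fun k _ => by positivity, ?_⟩
  intro N hN hdN a zp zm ⟨_, hz, hzp, hzm⟩
  have hsupp : ∀ k ∈ c.support, k < N := fun k hk =>
    (Nat.lt_succ_of_le (Finset.le_sup (f := id) hk)).trans_le hdN
  rw [finsupp_sum_eq_sum_fin c _ (by simp) hsupp] at hc
  have heval : ∀ x : ℝ, P.eval x =
      ∑ k : Fin N, c k * (Chebyshev.T ℝ ((k : ℕ) : ℤ)).eval x := by
    intro x
    rw [hc, eval_finsetSum]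
    simp only [eval_smul, smul_eq_mul]
  have hB' : ∀ x ∈ Set.Icc (-1:ℝ) 1,
      |∑ k : Fin N, c k * (Chebyshev.T ℝ ((k : ℕ) : ℤ)).eval x| ≤ B := by
    intro x hx
    rw [← heval]
    exact hB ⟨x, hx⟩
  have hs : sInt (ρ - ∑ i, a i • lam i) (fun x => P.eval (x : ℝ)) =
      ∑ k : Fin N, c k * zp k - ∑ k : Fin N, c k * zm k := by
    simp only [heval]
    rw [sInt_sum_mul _ (fun k : Fin N => c k)
      (fun k x => (Chebyshev.T ℝ ((k : ℕ) : ℤ)).eval (x : ℝ)) (fun k => by fun_prop),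
      ← Finset.sum_sub_distrib]
    refine Finset.sum_congr rfl fun k _ => ?_
    rw [← mul_sub, ← Pi.sub_apply, hz, chebMom]
  rw [hs, finsupp_sum_eq_sum_fin c _ (by simp) hsupp]
  have h1 := abs_sum_mul_le_of_posSemidef_Toep hN hzp (fun k => c k) hB'
  have h2 := abs_sum_mul_le_of_posSemidef_Toep hN hzm (fun k => c k) hB'
  rw [mul_add]
  linarith [le_abs_self (∑ k : Fin N, c k * zp k), neg_abs_le (∑ k : Fin N, c k * zm k)]

/-- The optimal value of the truncated program is at most the objective of (Main). -/
theorem exists_trunFeas_trunObj_eq_mainObj {m n N : ℕ} (hN : 0 < N)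
    (lam : Fin m → SignedMeasure (Set.Icc (-1:ℝ) 1)) (ρ : SignedMeasure (Set.Icc (-1:ℝ) 1))
    (Mmat : Matrix (Fin n) (Fin m) ℝ) (bvec : Fin n → ℝ) (ε η : ℝ) (p' : ℝ≥0∞) [Fact (1 ≤ p')]
    {a : Fin m → ℝ} (ha : Mmat.mulVec a = bvec) :
    ∃ zp zm : Fin N → ℝ, trunFeas lam ρ Mmat bvec a zp zm ∧
      trunObj hN ε η p' a zp zm = mainObj lam ρ ε η p' a := by
  refine ⟨_, _, ⟨ha, rfl,
    posSemidef_Toep_moments N (ρ - ∑ i, a i • lam i).toJordanDecomposition.posPart,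
    posSemidef_Toep_moments N (ρ - ∑ i, a i • lam i).toJordanDecomposition.negPart⟩, ?_⟩
  simp [trunObj, mainObj, tvNorm_eq]

/-- Limit points of minimizers of the truncated programs are minimizers of (Main). -/
theorem isMainMin_of_tendsto {m n : ℕ} (lam : Fin m → SignedMeasure (Set.Icc (-1:ℝ) 1))
    (ρ : SignedMeasure (Set.Icc (-1:ℝ) 1)) (Mmat : Matrix (Fin n) (Fin m) ℝ) (bvec : Fin n → ℝ)
    (ε η : ℝ) (p' : ℝ≥0∞) [Fact (1 ≤ p')]
    (a : (N : ℕ) → Fin m → ℝ) (zp zm : (N : ℕ) → Fin N → ℝ)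
    (hminN : ∀ (N : ℕ) (hN : 0 < N),
      trunFeas lam ρ Mmat bvec (a N) (zp N) (zm N) ∧
      ∀ (a' : Fin m → ℝ) (zp' zm' : Fin N → ℝ),
        trunFeas lam ρ Mmat bvec a' zp' zm' →
        trunObj hN ε η p' (a N) (zp N) (zm N) ≤ trunObj hN ε η p' a' zp' zm')
    {φ : ℕ → ℕ} (hφ : Filter.Tendsto φ Filter.atTop Filter.atTop) {alim : Fin m → ℝ}
    (hlim : Filter.Tendsto (fun k => a (φ k)) Filter.atTop (nhds alim)) :
    IsMainMin lam ρ Mmat bvec ε η p' alim := by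
  have hpos : ∀ᶠ k in Filter.atTop, 0 < φ k := hφ.eventually_gt_atTop 0
  refine ⟨?_, fun a' ha' => ?_⟩
  · have hM : Filter.Tendsto (fun k => Mmat.mulVec (a (φ k))) Filter.atTop
        (nhds (Mmat.mulVec alim)) :=
      ((by fun_prop : Continuous fun v : Fin m → ℝ => Mmat.mulVec v).tendsto alim).comp hlim
    refine tendsto_nhds_unique hM (tendsto_const_nhds.congr' ?_)
    filter_upwards [hpos] with k hk using (hminN _ hk).1.1.symm
  have hnorm : Filter.Tendsto
      (fun k => η / ε * ‖(WithLp.equiv p' (Fin m → ℝ)).symm (a (φ k))‖) Filter.atTop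
      (nhds (η / ε * ‖(WithLp.equiv p' (Fin m → ℝ)).symm alim‖)) :=
    ((((PiLp.continuous_toLp p' fun _ : Fin m => ℝ).tendsto alim).comp hlim).norm).const_mul _
  rw [mainObj, ← le_sub_iff_add_le]
  refine tvNorm_le_of_forall_polynomial _ _ fun P B hB => ?_
  obtain ⟨C, d, hC, hbound⟩ := exists_sInt_le_of_trunFeas lam ρ Mmat bvec P hB
  have hB0 : 0 ≤ B := (abs_nonneg _).trans (hB ⟨0, by norm_num⟩)
  let f : C(Set.Icc (-1:ℝ) 1, ℝ) := P.toContinuousMapOn _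
  have hcont : Continuous fun v : Fin m → ℝ => sInt (ρ - ∑ i, v i • lam i) f := by
    simp only [sInt_sub_sum_smul]
    fun_prop
  have hL := (hcont.tendsto alim).comp hlim
  have hinv : Filter.Tendsto (fun k => B + C / (φ k : ℝ)) Filter.atTop (nhds (B + 0)) :=
    ((tendsto_natCast_atTop_atTop.comp hφ).const_div_atTop C).const_add B
  have hR := hinv.mul (hnorm.const_sub (mainObj lam ρ ε η p' a'))
  rw [add_zero, mul_comm] at hR
  refine le_of_tendsto_of_tendsto hL hR ?_
  filter_upwards [hpos, hφ.eventually_ge_atTop d] with k hk hkd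
  refine (hbound (φ k) hk hkd _ _ _ (hminN _ hk).1).trans ?_
  refine mul_le_mul_of_nonneg_left ?_ (by positivity)
  obtain ⟨zp', zm', hfeas, hobj⟩ :=
    exists_trunFeas_trunObj_eq_mainObj hk lam ρ Mmat bvec ε η p' ha'
  have h := (hminN _ hk).2 a' zp' zm' hfeas
  rw [hobj, trunObj] at h
  linarith

/-- (Theorem 4.3 of the paper.) Convergence of the minimizers of the
truncated semidefinite programs to minimizers of the measure-norm minimization (Main). -/
theorem trunSDP_minimizers_converge_to_main_minimizer
    {m n : ℕ} (hnm : n ≤ m)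
    (lam : Fin m → SignedMeasure (Set.Icc (-1:ℝ) 1))
    (ρ : SignedMeasure (Set.Icc (-1:ℝ) 1))
    -- a basis of the n-dimensional subspace V of C[-1,1]
    (v : Fin n → C(Set.Icc (-1:ℝ) 1, ℝ)) (hv : LinearIndependent ℝ v)
    -- the matrix M and vector b with M_{j,i} = ℓ_i(v_j), b_j = Q(v_j)
    (Mmat : Matrix (Fin n) (Fin m) ℝ)
    (hM : Mmat = Matrix.of fun j i => sInt (lam i) (v j))
    (bvec : Fin n → ℝ) (hb : bvec = fun j => sInt ρ (v j))
    (ε η : ℝ) (hε : 0 < ε) (hη : 0 < η)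
    (p p' : ℝ≥0∞) [Fact (1 ≤ p)] [Fact (1 ≤ p')] (hpp' : p⁻¹ + p'⁻¹ = 1)
    -- for each N ≥ 1, (a N, zp N, zm N) is a minimizer of (TrunSDP)_N
    (a : (N : ℕ) → Fin m → ℝ) (zp zm : (N : ℕ) → Fin N → ℝ)
    (hminN : ∀ (N : ℕ) (hN : 0 < N),
      trunFeas lam ρ Mmat bvec (a N) (zp N) (zm N) ∧
      ∀ (a' : Fin m → ℝ) (zp' zm' : Fin N → ℝ),
        trunFeas lam ρ Mmat bvec a' zp' zm' →
        trunObj hN ε η p' (a N) (zp N) (zm N) ≤ trunObj hN ε η p' a' zp' zm')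
    -- program (Main) admits a minimizer
    (hmain : ∃ a₀, IsMainMin lam ρ Mmat bvec ε η p' a₀) :
    -- (1) if (Main) has a unique minimizer, then a^{(N)} converges to it
    (∀ aopt : Fin m → ℝ, IsMainMin lam ρ Mmat bvec ε η p' aopt →
      (∀ a' : Fin m → ℝ, IsMainMin lam ρ Mmat bvec ε η p' a' → a' = aopt) →
      Filter.Tendsto (fun N => a N) Filter.atTop (nhds aopt)) ∧
    -- (2) in general, every subsequence admits a further subsequence converging to
    -- some minimizer of (Main)
    (∀ φ : ℕ → ℕ, StrictMono φ → ∃ ψ : ℕ → ℕ, StrictMono ψ ∧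
      ∃ alim : Fin m → ℝ, IsMainMin lam ρ Mmat bvec ε η p' alim ∧
        Filter.Tendsto (fun k => a (φ (ψ k))) Filter.atTop (nhds alim)) := by

  obtain ⟨a₀, ha₀, -⟩ := hmain
  have hbdd : ∀ N, 0 < N → a N ∈ Metric.closedBall (0 : Fin m → ℝ)
      (mainObj lam ρ ε η p' a₀ / (η / ε)) := by
    intro N hN
    obtain ⟨zp', zm', hfeas, hobj⟩ :=
      exists_trunFeas_trunObj_eq_mainObj hN lam ρ Mmat bvec ε η p' ha₀
    have h := (hminN N hN).2 a₀ zp' zm' hfeas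
    rw [hobj, trunObj] at h
    have hzp := (abs_nonneg _).trans
      (abs_le_of_posSemidef_Toep hN (hminN N hN).1.2.2.1 ⟨0, hN⟩)
    have hzm := (abs_nonneg _).trans
      (abs_le_of_posSemidef_Toep hN (hminN N hN).1.2.2.2 ⟨0, hN⟩)
    have hnorm : ‖a N‖ ≤ ‖(WithLp.equiv p' (Fin m → ℝ)).symm (a N)‖ :=
      (pi_norm_le_iff_of_nonneg (norm_nonneg _)).2 fun i =>
        PiLp.norm_apply_le ((WithLp.equiv p' (Fin m → ℝ)).symm (a N)) i
    rw [mem_closedBall_zero_iff, le_div_iff₀ (div_pos hη hε), mul_comm]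
    have := mul_le_mul_of_nonneg_left hnorm (div_pos hη hε).le
    linarith
  have hsub : ∀ φ : ℕ → ℕ, Filter.Tendsto φ Filter.atTop Filter.atTop →
      ∃ ψ : ℕ → ℕ, StrictMono ψ ∧ ∃ alim : Fin m → ℝ, IsMainMin lam ρ Mmat bvec ε η p' alim ∧
        Filter.Tendsto (fun k => a (φ (ψ k))) Filter.atTop (nhds alim) := by
    intro φ hφ
    obtain ⟨alim, -, ψ, hψ, hlim⟩ := tendsto_subseq_of_frequently_bounded
      (x := fun k => a (φ k)) Metric.isBounded_closedBall
      ((hφ.eventually_gt_atTop 0).mono fun k hk => hbdd (φ k) hk).frequently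
    exact ⟨ψ, hψ, alim, isMainMin_of_tendsto lam ρ Mmat bvec ε η p' a zp zm hminN
      (hφ.comp hψ.tendsto_atTop) hlim, hlim⟩
  refine ⟨fun aopt _ huniq => ?_, fun φ hφ => hsub φ hφ.tendsto_atTop⟩
  refine Filter.tendsto_of_subseq_tendsto fun φ hφ => ?_
  obtain ⟨ψ, -, alim, hmin, hlim⟩ := hsub φ hφ
  exact ⟨ψ, huniq alim hmin ▸ hlim⟩

end
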